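/- arXiv:math/0203261 — 2 statements merged into one kernel-verified Lean document; each statement's English description precedes it below -/
import Mathlib

section
/- (Linear-algebraic Hall lemma) Let K be a field, let e_1, e_2, …, e_m be a basis of the m-dimensional vector space K^m, and let T_1, T_2, …, T_k be linear transformations from K^m to K^n. Suppose that for every l and every l-tuple {e_{i_1}, …, e_{i_l}} of distinct basis vectors, the K-linear span of the vectors {T_j(e_{i_t}) : 1 ≤ t ≤ l, 1 ≤ j ≤ k} has dimension at least l. Then there exists a function φ : {1, 2, …, m} → {1, 2, …, k} such that the vectors T_{φ(1)}(e_1), T_{φ(2)}(e_2), …, T_{φ(m)}(e_m) are linearly independent. -/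
open Module

/-- Rado's theorem for vector spaces: a finite family of finite sets of vectors such that any `l` of
them together span a subspace of dimension at least `l` has a linearly independent transversal. -/
theorem exists_linearIndependent_transversal {K V ι : Type*} [Field K] [AddCommGroup V]
    [Module K V] [FiniteDimensional K V] [Fintype ι] (A : ι → Finset V)
    (hA : ∀ s : Finset ι,
      s.card ≤ finrank K (Submodule.span K {v : V | ∃ i ∈ s, v ∈ A i})) :
    ∃ f : ι → V, (∀ i, f i ∈ A i) ∧ LinearIndependent K f := by
  classical
  induction hN : ∑ i, (A i).card using Nat.strong_induction_on generalizing A with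
  | _ N ih =>
  subst hN
  by_cases hcard : ∀ i, (A i).card ≤ 1
  · have hne (i : ι) : (A i).Nonempty := by
      by_contra h
      rw [Finset.not_nonempty_iff_eq_empty] at h
      have := hA {i}
      simp [h] at this
    choose f hf using hne
    refine ⟨f, hf, linearIndependent_iff_card_le_finrank_span.2 ((hA Finset.univ).trans ?_)⟩
    refine Submodule.finrank_mono (Submodule.span_mono ?_)
    rintro v ⟨i, -, hv⟩
    exact ⟨i, Finset.card_le_one.1 (hcard i) _ (hf i) _ hv⟩
  push Not at hcard
  obtain ⟨i, hi⟩ := hcard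
  obtain ⟨x, hx, y, hy, hxy⟩ := Finset.one_lt_card.1 hi
  -- If a point of `A i` cannot be removed, Hall's condition then fails at some set containing `i`.
  have shrink (z : V) (hz : z ∈ A i) :
      (∃ f : ι → V, (∀ j, f j ∈ A j) ∧ LinearIndependent K f) ∨
      ∃ s : Finset ι, i ∈ s ∧ finrank K (Submodule.span K
        {v : V | ∃ j ∈ s, v ∈ Function.update A i ((A i).erase z) j}) < s.card := by
    have hsub (j : ι) : Function.update A i ((A i).erase z) j ⊆ A j := by
      rcases eq_or_ne j i with rfl | hj
      · simpa using Finset.erase_subset z (A j)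
      · simp [hj]
    by_cases h : ∀ s : Finset ι, s.card ≤ finrank K (Submodule.span K
        {v : V | ∃ j ∈ s, v ∈ Function.update A i ((A i).erase z) j})
    · left
      obtain ⟨f, hf, hli⟩ := ih _ (Finset.sum_lt_sum
        (fun j _ => Finset.card_le_card (hsub j))
        ⟨i, Finset.mem_univ i, by simpa using Finset.card_erase_lt_of_mem hz⟩) _ h rfl
      exact ⟨f, fun j => hsub j (hf j), hli⟩
    · right
      push Not at h
      obtain ⟨s, hs⟩ := h
      refine ⟨s, ?_, hs⟩
      by_contra his
      refine absurd (hA s) (not_le.2 (lt_of_le_of_lt ?_ hs))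
      refine Submodule.finrank_mono (Submodule.span_mono ?_)
      rintro v ⟨j, hj, hv⟩
      exact ⟨j, hj, by rwa [Function.update_of_ne (by rintro rfl; exact his hj)]⟩
  obtain h | ⟨s, his, hs⟩ := shrink x hx
  · exact h
  obtain h | ⟨t, hit, ht⟩ := shrink y hy
  · exact h
  exfalso
  set U := Submodule.span K {v : V | ∃ j ∈ s, v ∈ Function.update A i ((A i).erase x) j}
  set W := Submodule.span K {v : V | ∃ j ∈ t, v ∈ Function.update A i ((A i).erase y) j}
  have memU (j : ι) (hj : j ∈ s) (v : V) (hv : v ∈ A j) (h : j = i → v ≠ x) : v ∈ U := by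
    refine Submodule.subset_span ⟨j, hj, ?_⟩
    rcases eq_or_ne j i with rfl | hji
    · simpa using ⟨h rfl, hv⟩
    · simpa [hji] using hv
  have memW (j : ι) (hj : j ∈ t) (v : V) (hv : v ∈ A j) (h : j = i → v ≠ y) : v ∈ W := by
    refine Submodule.subset_span ⟨j, hj, ?_⟩
    rcases eq_or_ne j i with rfl | hji
    · simpa using ⟨h rfl, hv⟩
    · simpa [hji] using hv
  have hsup : (s ∪ t).card ≤ finrank K (U ⊔ W : Submodule K V) := by
    refine (hA _).trans (Submodule.finrank_mono (Submodule.span_le.2 ?_))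
    rintro v ⟨j, hj, hv⟩
    by_cases hji : j = i
    · subst hji
      by_cases hvx : v = x
      · exact Submodule.mem_sup_right (memW j hit v hv fun _ => hvx ▸ hxy)
      · exact Submodule.mem_sup_left (memU j his v hv fun _ => hvx)
    · rcases Finset.mem_union.1 hj with hj | hj
      · exact Submodule.mem_sup_left (memU j hj v hv fun h => absurd h hji)
      · exact Submodule.mem_sup_right (memW j hj v hv fun h => absurd h hji)
  have hinf : ((s ∩ t).erase i).card ≤ finrank K (U ⊓ W : Submodule K V) := by
    refine (hA _).trans (Submodule.finrank_mono (Submodule.span_le.2 ?_))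
    rintro v ⟨j, hj, hv⟩
    obtain ⟨hji, hj⟩ := Finset.mem_erase.1 hj
    obtain ⟨hjs, hjt⟩ := Finset.mem_inter.1 hj
    exact ⟨memU j hjs v hv fun h => absurd h hji, memW j hjt v hv fun h => absurd h hji⟩
  have hdim := Submodule.finrank_sup_add_finrank_inf_eq U W
  have hst := Finset.card_union_add_card_inter s t
  have herase := Finset.card_erase_add_one (Finset.mem_inter.2 ⟨his, hit⟩)
  omega

/-- Linear-algebraic Hall lemma: if `e₁, …, e_m` is a basis of `K^m` and `T₁, …, T_k` are
linear maps `K^m → K^n` such that every `l`-tuple of distinct basis vectors has the span of all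
its images at least `l`-dimensional, then one can pick `φ : {1,…,m} → {1,…,k}` with
`T_{φ(1)}(e₁), …, T_{φ(m)}(e_m)` linearly independent. -/
theorem linear_hall_lemma {K : Type*} [Field K] {m n k : ℕ}
    (e : Basis (Fin m) K (Fin m → K))
    (T : Fin k → ((Fin m → K) →ₗ[K] (Fin n → K)))
    (hT : ∀ s : Finset (Fin m),
      s.card ≤ finrank K (Submodule.span K {v : Fin n → K | ∃ i ∈ s, ∃ j, v = T j (e i)})) :
    ∃ φ : Fin m → Fin k, LinearIndependent K fun i => T (φ i) (e i) := by
  classical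
  obtain ⟨f, hf, hli⟩ := exists_linearIndependent_transversal (K := K)
    (fun i => Finset.univ.image fun j => T j (e i))
    (fun s => (hT s).trans <| Submodule.finrank_mono <| Submodule.span_mono <| by
      rintro v ⟨i, hi, j, rfl⟩
      exact ⟨i, hi, Finset.mem_image_of_mem _ (Finset.mem_univ j)⟩)
  have hφ (i : Fin m) : ∃ j, T j (e i) = f i := by simpa using hf i
  choose φ hφ using hφ
  exact ⟨φ, by simpa only [hφ] using hli⟩
end

section
/- Let K be a field and let R be an infinite-dimensional affine K-algebra without zero divisors. Then the following are equivalent: (1) R is amenable; (2) R is not paradoxical; (3) there exists a K-basis {e_i}_{i=1}^∞ of R and an invariant finitely additive dimension-measure on R with respect to {e_i}_{i=1}^∞. -/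
open Filter Module

/-- `W·r`: the image of the finite dimensional subspace `W` under right multiplication
by `r`. -/
noncomputable def rightMulSubmodule (K : Type*) [Field K] {R : Type*} [Ring R] [Algebra K R]
    (W : Submodule K R) (r : R) : Submodule K R :=
  W.map (LinearMap.mulRight K r)

/-- A Følner exhaustion of a `K`-algebra `R`: an increasing sequence of finite dimensional
subspaces exhausting `R` such that for every `r ∈ R`,
`dim (Wₙ·r + Wₙ) / dim Wₙ → 1`. -/
def FolnerExhaustion (K : Type*) [Field K] (R : Type*) [Ring R] [Algebra K R]
    (W : ℕ → Submodule K R) : Prop :=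
  Monotone W ∧ (∀ n, FiniteDimensional K (W n)) ∧ (∀ x : R, ∃ n, x ∈ W n) ∧
    ∀ r : R,
      Tendsto (fun n => (finrank K ↥(rightMulSubmodule K (W n) r ⊔ W n) : ℝ) / finrank K (W n))
        atTop (nhds 1)

/-- An affine algebra is (left) amenable if it admits a Følner exhaustion. -/
def AmenableAlgebra (K : Type*) [Field K] (R : Type*) [Ring R] [Algebra K R] : Prop :=
  ∃ W : ℕ → Submodule K R, FolnerExhaustion K R W


/-- A subset `L ⊆ R` is regular with respect to the basis enumeration `e : ℕ → R` if it is
linearly independent over `K` and is a finite disjoint union of sets of the form `Aᵢ·rᵢ`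
with `Aᵢ` a subset of the basis and `rᵢ ∈ R`. -/
def RegularSubset (K : Type*) [Field K] {R : Type*} [Ring R] [Algebra K R]
    (e : ℕ → R) (L : Set R) : Prop :=
  LinearIndependent K ((↑) : L → R) ∧
  ∃ (n : ℕ) (A : Fin n → Set R) (r : Fin n → R),
    (∀ i, A i ⊆ Set.range e) ∧
    L = ⋃ i, (fun a => a * r i) '' A i ∧
    Pairwise fun i j => Disjoint ((fun a => a * r i) '' A i) ((fun a => a * r j) '' A j)

/-- An invariant finitely additive dimension-measure with respect to a basis enumeration
`e : ℕ → R`: a nonnegative function on regular subsets with `μ({eᵢ}) = 1`, `μ ≤ 1`, finitely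
additive on disjoint regular sets, and invariant under right multiplication by nonzero
elements. -/
def DimensionMeasure (K : Type*) [Field K] {R : Type*} [Ring R] [Algebra K R]
    (e : ℕ → R) (μ : Set R → ℝ) : Prop :=
  (∀ L : Set R, RegularSubset K e L → 0 ≤ μ L) ∧
  μ (Set.range e) = 1 ∧
  (∀ A : Set R, RegularSubset K e A → μ A ≤ 1) ∧
  (∀ A B : Set R, RegularSubset K e A → RegularSubset K e B → Disjoint A B →
    RegularSubset K e (A ∪ B) → μ (A ∪ B) = μ A + μ B) ∧
  (∀ (A : Set R) (r : R), RegularSubset K e A → r ≠ 0 →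
    μ ((fun a => a * r) '' A) = μ A)

/-- `R` is paradoxical if every `K`-basis `{fᵢ}` of `R` indexed by `ℕ` can be partitioned into
finitely many pieces `A₁, …, A_m` for which there exist nonzero `g₁, h₁, …, g_m, h_m ∈ R` such
that the combined family of elements `a·gⱼ` and `a·hⱼ` (`a ∈ Aⱼ`) is linearly independent. -/
def ParadoxicalAlgebra (K : Type*) [Field K] (R : Type*) [Ring R] [Algebra K R] : Prop :=
  ∀ f : Basis ℕ K R, ∃ (m : ℕ) (A : Fin m → Set ℕ) (g h : Fin m → R),
    (∀ i, g i ≠ 0) ∧ (∀ i, h i ≠ 0) ∧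
    (⋃ i, A i) = Set.univ ∧
    Pairwise (Function.onFun Disjoint A) ∧
    LinearIndependent K (fun p : (i : Fin m) × (↥(A i) × Bool) =>
      f (p.2.1 : ℕ) * (cond p.2.2 (g p.1) (h p.1)))

open Submodule in
/-- **Rado's theorem** for finite families of finite sets of vectors. -/
theorem exists_linearIndependent_transversal_of_fintype {K M ι : Type*} [Field K] [AddCommGroup M]
    [Module K M] [Fintype ι] [DecidableEq M] (X : ι → Finset M)
    (hX : ∀ I : Finset ι, I.card ≤ finrank K (span K (↑(I.biUnion X) : Set M))) :
    ∃ x : ι → M, (∀ i, x i ∈ X i) ∧ LinearIndependent K x := by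
  classical
  induction hn : ∑ i, (X i).card using Nat.strong_induction_on generalizing X with
  | _ n ih =>
  by_cases hone : ∀ i, (X i).card ≤ 1
  · have hne : ∀ i, (X i).Nonempty := by
      intro i
      by_contra h
      have := hX {i}
      simp [Finset.not_nonempty_iff_eq_empty.1 h] at this
    choose x hx using hne
    have hXx : ∀ i, X i = {x i} := fun i => by
      obtain ⟨y, hy⟩ := Finset.card_eq_one.1 (le_antisymm (hone i) (Finset.card_pos.2 ⟨_, hx i⟩))
      have := hx i
      rw [hy, Finset.mem_singleton] at this
      rw [hy, this]
    refine ⟨x, hx, ?_⟩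
    rw [linearIndependent_iff_card_le_finrank_span]
    have := hX Finset.univ
    have h2 : (↑(Finset.univ.biUnion X) : Set M) = Set.range x := by
      ext y; simp [hXx, eq_comm]
    rw [h2] at this
    simpa [Set.finrank] using this
  · push Not at hone
    obtain ⟨i₀, hi₀⟩ := hone
    obtain ⟨x, hx, y, hy, hxy⟩ := Finset.one_lt_card.1 hi₀
    let X' : M → ι → Finset M := fun z => Function.update X i₀ ((X i₀).erase z)
    have hsub : ∀ z i, X' z i ⊆ X i := by
      intro z i
      by_cases hi : i = i₀
      · subst hi; simp [X', Finset.erase_subset]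
      · simp [X', hi]
    have hlt : ∀ z ∈ X i₀, ∑ i, (X' z i).card < n := by
      intro z hz
      rw [← hn]
      refine Finset.sum_lt_sum (fun i _ => Finset.card_le_card (hsub z i)) ⟨i₀, Finset.mem_univ _, ?_⟩
      simp only [X', Function.update_self]
      exact Finset.card_erase_lt_of_mem hz
    have hred : ∀ z ∈ X i₀, (∀ I : Finset ι,
        I.card ≤ finrank K (span K (↑(I.biUnion (X' z)) : Set M))) →
        ∃ x : ι → M, (∀ i, x i ∈ X i) ∧ LinearIndependent K x := by
      intro z hz hI
      obtain ⟨w, hw, hli⟩ := ih _ (hlt z hz) (X' z) hI rfl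
      exact ⟨w, fun i => hsub z i (hw i), hli⟩
    by_contra hno
    have key : ∀ z ∈ X i₀, ∃ I : Finset ι, i₀ ∉ I ∧
        finrank K (span K (↑(I.biUnion X ∪ (X i₀).erase z) : Set M)) ≤ I.card := by
      intro z hz
      by_contra! hI
      refine hno (hred z hz fun I => ?_)
      by_cases hi : i₀ ∈ I
      · have h1 := hI (I.erase i₀) (Finset.notMem_erase _ _)
        have h2 : I.biUnion (X' z) = (I.erase i₀).biUnion X ∪ (X i₀).erase z := by
          conv_lhs => rw [← Finset.insert_erase hi]
          rw [Finset.biUnion_insert, Finset.union_comm]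
          congr 1
          · refine Finset.biUnion_congr rfl fun a ha => ?_
            simp [X', Finset.ne_of_mem_erase ha]
          · simp [X']
        rw [h2]
        have := Finset.card_erase_add_one hi
        omega
      · have h2 : I.biUnion (X' z) = I.biUnion X := by
          refine Finset.biUnion_congr rfl fun a ha => ?_
          have : a ≠ i₀ := fun h => hi (h ▸ ha)
          simp [X', this]
        rw [h2]
        exact hX I
    obtain ⟨I, hI, hIx⟩ := key x hx
    obtain ⟨J, hJ, hJy⟩ := key y hy
    have hsum := finrank_sup_add_finrank_inf_eq
      (span K (↑(I.biUnion X ∪ (X i₀).erase x) : Set M))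
      (span K (↑(J.biUnion X ∪ (X i₀).erase y) : Set M))
    have hsup : (insert i₀ (I ∪ J)).card ≤ finrank K
        ↥(span K (↑(I.biUnion X ∪ (X i₀).erase x) : Set M) ⊔
          span K (↑(J.biUnion X ∪ (X i₀).erase y) : Set M)) := by
      refine (hX _).trans (finrank_mono ?_)
      rw [← span_union]
      apply span_mono
      intro w hw
      simp only [Finset.coe_biUnion, Set.mem_iUnion, Finset.mem_coe, Finset.mem_insert,
        Finset.mem_union, exists_prop, Set.mem_union, Finset.mem_biUnion, Finset.mem_erase] at hw ⊢
      obtain ⟨i, rfl | hi | hi, hw⟩ := hw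
      · by_cases hwx : w = x
        · subst hwx; tauto
        · tauto
      · exact Or.inl (Or.inl ⟨i, hi, hw⟩)
      · exact Or.inr (Or.inl ⟨i, hi, hw⟩)
    have hinf : (I ∩ J).card ≤ finrank K
        ↥(span K (↑(I.biUnion X ∪ (X i₀).erase x) : Set M) ⊓
          span K (↑(J.biUnion X ∪ (X i₀).erase y) : Set M)) := by
      refine (hX _).trans (finrank_mono (le_inf (span_mono ?_) (span_mono ?_)))
      · intro w hw
        simp only [Finset.coe_biUnion, Set.mem_iUnion, Finset.mem_coe, Finset.mem_inter,
          exists_prop, Finset.mem_union, Finset.mem_biUnion] at hw ⊢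
        obtain ⟨i, hi, hw⟩ := hw
        exact Or.inl ⟨i, hi.1, hw⟩
      · intro w hw
        simp only [Finset.coe_biUnion, Set.mem_iUnion, Finset.mem_coe, Finset.mem_inter,
          exists_prop, Finset.mem_union, Finset.mem_biUnion] at hw ⊢
        obtain ⟨i, hi, hw⟩ := hw
        exact Or.inl ⟨i, hi.2, hw⟩
    rw [Finset.card_insert_of_notMem (by simp [hI, hJ])] at hsup
    have := Finset.card_union_add_card_inter I J
    omega

open Submodule in
/-- **Rado's theorem** for arbitrary families of finite sets of vectors. -/
theorem exists_linearIndependent_transversal_s10 {K M ι : Type*} [Field K] [AddCommGroup M]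
    [Module K M] [DecidableEq M] (X : ι → Finset M)
    (hX : ∀ I : Finset ι, I.card ≤ finrank K (span K (↑(I.biUnion X) : Set M))) :
    ∃ x : ι → M, (∀ i, x i ∈ X i) ∧ LinearIndependent K x := by
  classical
  have hfin : ∀ s : Finset ι, ∃ x : (i : s) → {y // y ∈ X i},
      LinearIndependent K fun i => (x i : M) := by
    intro s
    obtain ⟨x, hx, hli⟩ := exists_linearIndependent_transversal_of_fintype (K := K)
      (fun i : s => X i) fun I => by
        have hI : (I.map (Function.Embedding.subtype (· ∈ s))).biUnion X = I.biUnion fun i => X i := by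
          ext; simp
        have := hX (I.map (Function.Embedding.subtype (· ∈ s)))
        rwa [hI, Finset.card_map] at this
    exact ⟨fun i => ⟨x i, hx i⟩, hli⟩
  choose g hg using hfin
  obtain ⟨χ, hχ⟩ := Finset.rado_selection_subtype (β := fun i => {y // y ∈ X i}) g
  refine ⟨fun i => χ i, fun i => (χ i).2, ?_⟩
  rw [linearIndependent_iff_finset_linearIndependent]
  intro s
  obtain ⟨t, hst, h⟩ := hχ s
  have := (hg t).comp (Set.inclusion hst) (Set.inclusion_injective hst)
  convert! this using 1
  funext i
  simp [h i]

open Pointwise in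
/-- If right multiplication by a finite dimensional subspace expands every nonzero finite
dimensional subspace by a fixed factor, then the algebra is paradoxical. -/
theorem paradoxicalAlgebra_of_expansion (K : Type*) [Field K] (R : Type*) [Ring R] [Algebra K R]
    (E : Submodule K R) (hE : E.FG) (ε : ℝ) (hε : 0 < ε)
    (h : ∀ V : Submodule K R, V.FG → (1 + ε) * finrank K V ≤ finrank K ↥(V * E)) :
    ParadoxicalAlgebra K R := by
  classical
  have hpow : ∀ n : ℕ, ∀ V : Submodule K R, V.FG →
      (1 + ε) ^ n * finrank K V ≤ finrank K ↥(V * E ^ n) := by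
    intro n
    induction n with
    | zero =>
      intro V _
      rw [pow_zero, one_mul, Submodule.pow_zero, mul_one]
    | succ n ih =>
      intro V hV
      have h1 := ih V hV
      have h2 := h (V * E ^ n) (hV.mul (hE.pow n))
      rw [pow_succ E, ← mul_assoc]
      refine le_trans ?_ h2
      rw [pow_succ', mul_assoc]
      gcongr
  obtain ⟨n, hn⟩ := pow_unbounded_of_one_lt (2 : ℝ) (by linarith : 1 < 1 + ε)
  obtain ⟨S, hS⟩ := hE.pow n
  intro f
  have hrado : ∀ I : Finset (ℕ × Bool), I.card ≤ finrank K
      (Submodule.span K (↑(I.biUnion fun p => S.image (f p.1 * ·)) : Set R)) := by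
    intro I
    let A : Finset ℕ := I.image Prod.fst
    have hIA : I.card ≤ A.card * 2 := by
      have : I ⊆ A ×ˢ Finset.univ := fun p hp => by
        exact Finset.mem_product.2 ⟨Finset.mem_image_of_mem _ hp, Finset.mem_univ _⟩
      simpa using Finset.card_le_card this
    have hV : finrank K (Submodule.span K (↑(A.image f) : Set R)) = A.card := by
      rw [finrank_span_finset_eq_card, Finset.card_image_of_injective _ f.injective]
      have := f.linearIndependent.linearIndepOn_id
      exact this.mono (by simp)
    have h1 := hpow n (Submodule.span K (↑(A.image f) : Set R)) ⟨_, rfl⟩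
    rw [hV, ← hS, Submodule.span_mul_span] at h1
    have h2 : (↑(A.image f) : Set R) * (↑S : Set R) =
        (↑(I.biUnion fun p => S.image (f p.1 * ·)) : Set R) := by
      ext x
      simp only [Set.mem_mul, Finset.coe_image, Set.mem_image, Finset.mem_coe, Finset.coe_biUnion,
        Set.mem_iUnion, A]
      aesop
    rw [h2] at h1
    have h3 : (2 : ℝ) * A.card ≤ (1 + ε) ^ n * A.card := by gcongr
    have h4 := h3.trans h1
    norm_cast at h4
    omega
  obtain ⟨x, hx, hli⟩ := exists_linearIndependent_transversal_s10 (K := K) _ hrado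
  simp only [Finset.mem_image] at hx
  choose s hs hsx using hx
  have hx0 : ∀ p, x p ≠ 0 := hli.ne_zero
  have hs0 : ∀ p, s p ≠ 0 := fun p h0 => hx0 p (by rw [← hsx, h0, mul_zero])
  let T := {y : S // (y : R) ≠ 0}
  let t : ℕ → T × T := fun a => (⟨⟨s (a, true), hs _⟩, hs0 _⟩, ⟨⟨s (a, false), hs _⟩, hs0 _⟩)
  let φ := Fintype.equivFin (T × T)
  refine ⟨Fintype.card (T × T), fun i => {a | φ (t a) = i}, fun i => (φ.symm i).1.1,
    fun i => (φ.symm i).2.1, fun i => (φ.symm i).1.2, fun i => (φ.symm i).2.2, ?_, ?_, ?_⟩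
  · ext a; simp
  · intro i j hij
    rw [Function.onFun, Set.disjoint_left]
    rintro a rfl h
    exact hij h
  · let ψ : ((i : Fin (Fintype.card (T × T))) × (↥{a | φ (t a) = i} × Bool)) → ℕ × Bool :=
      fun p => (p.2.1, p.2.2)
    have hψ : Function.Injective ψ := by
      rintro ⟨i, ⟨a, rfl⟩, b⟩ ⟨j, ⟨a', rfl⟩, b'⟩ h
      simp only [ψ, Prod.mk.injEq] at h
      obtain ⟨rfl, rfl⟩ := h
      rfl
    convert! hli.comp ψ hψ using 1
    funext p
    obtain ⟨i, ⟨a, rfl⟩, b⟩ := p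
    cases b <;> simp [ψ, t, ← hsx]

/-- If no finite dimensional subspace expands uniformly, then almost invariant subspaces of
arbitrarily large dimension exist. -/
theorem exists_almost_invariant_of_le_finrank {K R : Type*} [Field K] [Ring R] [Algebra K R]
    [NoZeroDivisors R] (f : Basis ℕ K R)
    (hF : ∀ E : Submodule K R, E.FG → ∀ ε : ℝ, 0 < ε →
      ∃ V : Submodule K R, V.FG ∧ (finrank K ↥(V * E) : ℝ) < (1 + ε) * finrank K V)
    (E : Submodule K R) (hE : E.FG) (ε : ℝ) (hε : 0 < ε) (N : ℕ) :
    ∃ V : Submodule K R, V.FG ∧ N ≤ finrank K V ∧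
      (finrank K ↥(V * E) : ℝ) < (1 + ε) * finrank K V := by
  classical
  let B : Finset R := (Finset.range (2 * N)).image f
  have hB : finrank K (Submodule.span K (↑B : Set R)) = 2 * N := by
    rw [finrank_span_finset_eq_card, Finset.card_image_of_injective _ f.injective,
      Finset.card_range]
    exact f.linearIndependent.linearIndepOn_id.mono (by simp [B])
  obtain ⟨V, hV, hVE⟩ := hF (E ⊔ Submodule.span K (↑B : Set R)) (hE.sup ⟨B, rfl⟩) (min ε 1)
    (by positivity)
  have hfin : FiniteDimensional K ↥(V * (E ⊔ Submodule.span K (↑B : Set R))) :=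
    Module.Finite.iff_fg.2 (hV.mul (hE.sup ⟨B, rfl⟩))
  have hpos : 0 < finrank K V := by
    rcases Nat.eq_zero_or_pos (finrank K V) with h | h
    · rw [h, Nat.cast_zero, mul_zero] at hVE
      exact absurd hVE (not_lt.2 (Nat.cast_nonneg _))
    · exact h
  have := Module.Finite.iff_fg.2 hV
  obtain ⟨v, hv⟩ := (finrank_pos_iff_exists_ne_zero (R := K) (M := V)).1 hpos
  have hv0 : (v : R) ≠ 0 := by simpa using hv
  have h1 : 2 * N ≤ finrank K ↥(V * (E ⊔ Submodule.span K (↑B : Set R))) := by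
    have hinj : Function.Injective (LinearMap.mulLeft K (v : R)) := by
      rw [injective_iff_map_eq_zero]
      intro a ha
      simpa [hv0] using ha
    rw [← hB, (Submodule.equivMapOfInjective _ hinj _).finrank_eq]
    refine Submodule.finrank_mono ?_
    rintro _ ⟨b, hb, rfl⟩
    exact Submodule.mul_mem_mul v.2 (Submodule.mem_sup_right hb)
  have hpos' : (0 : ℝ) < finrank K V := by exact_mod_cast hpos
  refine ⟨V, hV, ?_, ?_⟩
  · have h2 : ((2 * N : ℕ) : ℝ) ≤ finrank K ↥(V * (E ⊔ Submodule.span K (↑B : Set R))) := by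
      exact_mod_cast h1
    have h3 : (1 + min ε 1) * finrank K V ≤ (1 + 1) * (finrank K V : ℝ) := by
      gcongr; exact min_le_right _ _
    have h4 : ((2 * N : ℕ) : ℝ) < 2 * (finrank K V : ℝ) := by linarith
    norm_cast at h4
    omega
  · have h2 : finrank K ↥(V * E) ≤ finrank K ↥(V * (E ⊔ Submodule.span K (↑B : Set R))) :=
      Submodule.finrank_mono (mul_le_mul_right le_sup_left V)
    have h3 : (1 + min ε 1) * finrank K V ≤ (1 + ε) * (finrank K V : ℝ) := by
      gcongr; exact min_le_left _ _
    have h2' : (finrank K ↥(V * E) : ℝ) ≤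
      finrank K ↥(V * (E ⊔ Submodule.span K (↑B : Set R))) := by exact_mod_cast h2
    linarith

/-- If no finite dimensional subspace expands uniformly, then every finite dimensional subspace
is contained in an almost invariant one. -/
theorem exists_almost_invariant_ge {K R : Type*} [Field K] [Ring R] [Algebra K R]
    [NoZeroDivisors R] (f : Basis ℕ K R)
    (hF : ∀ E : Submodule K R, E.FG → ∀ ε : ℝ, 0 < ε →
      ∃ V : Submodule K R, V.FG ∧ (finrank K ↥(V * E) : ℝ) < (1 + ε) * finrank K V)
    (E : Submodule K R) (hE : E.FG) (ε : ℝ) (hε : 0 < ε) (U : Submodule K R) (hU : U.FG) :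
    ∃ V : Submodule K R, V.FG ∧ U ≤ V ∧ 0 < finrank K V ∧
      (finrank K ↥(V * E) : ℝ) ≤ (1 + ε) * finrank K V := by
  obtain ⟨N, hN⟩ := exists_nat_ge (2 * finrank K ↥(U * E) / ε)
  obtain ⟨V, hV, hNV, hVE⟩ :=
    exists_almost_invariant_of_le_finrank f hF E hE (ε / 2) (by positivity) (N + 1)
  have := Module.Finite.iff_fg.2 (hV.sup hU)
  have := Module.Finite.iff_fg.2 (hV.mul hE)
  have := Module.Finite.iff_fg.2 (hU.mul hE)
  have h1 : finrank K V ≤ finrank K ↥(V ⊔ U) := Submodule.finrank_mono le_sup_left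
  refine ⟨V ⊔ U, hV.sup hU, le_sup_right, by omega, ?_⟩
  rw [Submodule.sup_mul]
  have h2 : (finrank K ↥(V * E ⊔ U * E) : ℝ) ≤ finrank K ↥(V * E) + finrank K ↥(U * E) := by
    exact_mod_cast Submodule.finrank_add_le_finrank_add_finrank _ _
  have h1' : (finrank K V : ℝ) ≤ finrank K ↥(V ⊔ U) := by exact_mod_cast h1
  have h3 : (N : ℝ) ≤ finrank K V := by exact_mod_cast (by omega : N ≤ finrank K V)
  have h4 : 2 * (finrank K ↥(U * E) : ℝ) ≤ finrank K V * ε := (div_le_iff₀ hε).1 (hN.trans h3)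
  have h5 : (1 + ε) * (finrank K V : ℝ) ≤ (1 + ε) * finrank K ↥(V ⊔ U) := by gcongr
  linarith

/-- If no finite dimensional subspace expands uniformly, then the algebra is amenable. -/
theorem amenableAlgebra_of_almost_invariant {K R : Type*} [Field K] [Ring R] [Algebra K R]
    [NoZeroDivisors R] (f : Basis ℕ K R)
    (hF : ∀ E : Submodule K R, E.FG → ∀ ε : ℝ, 0 < ε →
      ∃ V : Submodule K R, V.FG ∧ (finrank K ↥(V * E) : ℝ) < (1 + ε) * finrank K V) :
    AmenableAlgebra K R := by
  classical
  let E : ℕ → Submodule K R := fun n =>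
    Submodule.span K (↑(insert 1 ((Finset.range n).image f)) : Set R)
  have hE : ∀ n, (E n).FG := fun n => ⟨_, rfl⟩
  have hone : ∀ n, (1 : R) ∈ E n := fun n => Submodule.subset_span (by simp)
  have hmem : ∀ r : R, ∃ n, ∀ m ≥ n, r ∈ E m := by
    intro r
    obtain ⟨n, hn⟩ := (f.repr r).support.exists_nat_subset_range
    refine ⟨n, fun m hm => Submodule.span_mono ?_ (f.mem_span_repr_support r)⟩
    rintro _ ⟨i, hi, rfl⟩
    have := Finset.mem_range.1 (hn hi)
    simp only [Finset.coe_insert, Finset.coe_image, Finset.coe_range, Set.mem_insert_iff,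
      Set.mem_image, Set.mem_Iio]
    exact Or.inr ⟨i, by omega, rfl⟩
  have hstep : ∀ (n : ℕ) (U : {V : Submodule K R // V.FG}), ∃ V : {V : Submodule K R // V.FG},
      U.1 ⊔ E n ≤ V.1 ∧ 0 < finrank K V.1 ∧
      (finrank K ↥(V.1 * E n) : ℝ) ≤ (1 + 1 / ((n : ℝ) + 1)) * finrank K V.1 := by
    intro n U
    obtain ⟨V, hV, h⟩ := exists_almost_invariant_ge f hF (E n) (hE n) (1 / ((n : ℝ) + 1))
      (by positivity) (U.1 ⊔ E n) (U.2.sup (hE n))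
    exact ⟨⟨V, hV⟩, h⟩
  choose next hnext hpos hinv using hstep
  let W : ℕ → {V : Submodule K R // V.FG} := fun n =>
    Nat.rec ⟨⊥, Submodule.fg_bot⟩ (fun n U => next n U) n
  have hW : ∀ n, W (n + 1) = next n (W n) := fun n => rfl
  refine ⟨fun n => (W n).1, monotone_nat_of_le_succ fun n => ?_,
    fun n => Module.Finite.iff_fg.2 (W n).2, fun x => ?_, fun r => ?_⟩
  · rw [hW]; exact le_sup_left.trans (hnext n (W n))
  · obtain ⟨n, hn⟩ := hmem x
    refine ⟨n + 1, ?_⟩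
    change x ∈ (W (n + 1)).1
    rw [hW]
    exact hnext n (W n) (Submodule.mem_sup_right (hn n le_rfl))
  · rw [← tendsto_add_atTop_iff_nat 1]
    have hlim : Tendsto (fun n : ℕ => 1 + 1 / ((n : ℝ) + 1)) atTop (nhds 1) := by
      simpa using tendsto_one_div_add_atTop_nhds_zero_nat.const_add (1 : ℝ)
    obtain ⟨N, hN⟩ := hmem r
    refine tendsto_of_tendsto_of_tendsto_of_le_of_le' tendsto_const_nhds hlim ?_ ?_
    · filter_upwards with n
      have := Module.Finite.iff_fg.2 (W (n + 1)).2
      have h0 : (0 : ℝ) < finrank K (W (n + 1)).1 := by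
        rw [hW]; exact_mod_cast hpos n (W n)
      have : FiniteDimensional K ↥(rightMulSubmodule K (W (n + 1)).1 r) :=
        Module.Finite.iff_fg.2 ((W (n + 1)).2.map _)
      rw [one_le_div h0]
      exact_mod_cast Submodule.finrank_mono le_sup_right
    · filter_upwards [eventually_ge_atTop N] with n hn
      have h0 : (0 : ℝ) < finrank K (W (n + 1)).1 := by
        rw [hW]; exact_mod_cast hpos n (W n)
      rw [div_le_iff₀ h0]
      refine le_trans ?_ ((hW n) ▸ hinv n (W n))
      have := Module.Finite.iff_fg.2 ((W (n + 1)).2.mul (hE n))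
      have hle : rightMulSubmodule K (W (n + 1)).1 r ⊔ (W (n + 1)).1 ≤ (W (n + 1)).1 * E n := by
        refine sup_le ?_ fun x hx => ?_
        · rintro _ ⟨x, hx, rfl⟩
          exact Submodule.mul_mem_mul hx (hN n hn)
        · simpa using Submodule.mul_mem_mul hx (hone n)
      exact_mod_cast Submodule.finrank_mono hle

/-- A non-paradoxical algebra with a countable basis and without zero divisors is amenable. -/
theorem amenableAlgebra_of_not_paradoxicalAlgebra {K R : Type*} [Field K] [Ring R] [Algebra K R]
    [NoZeroDivisors R] (hP : ¬ ParadoxicalAlgebra K R) : AmenableAlgebra K R := by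
  have hf : Nonempty (Basis ℕ K R) := by
    by_contra h
    exact hP fun f => (h ⟨f⟩).elim
  obtain ⟨f⟩ := hf
  by_contra hA
  refine hA (amenableAlgebra_of_almost_invariant f fun E hE ε hε => ?_)
  by_contra! h
  exact hP (paradoxicalAlgebra_of_expansion K R E hE ε hε h)

/-- A finite union of right translates of parts of the basis is regular if the translated
basis elements form an independent family. -/
theorem regularSubset_biUnion {K R ι : Type*} [Field K] [Ring R] [Algebra K R] {e : ℕ → R}
    (A : ι → Set ℕ) (r : ι → R)
    (hli : LinearIndependent K fun p : (i : ι) × A i => e p.2 * r p.1) (I : Finset ι) :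
    RegularSubset K e (⋃ i ∈ I, (fun a => a * r i) '' (e '' A i)) := by
  classical
  refine ⟨?_, I.card, fun j => e '' A (I.equivFin.symm j), fun j => r (I.equivFin.symm j),
    fun j => Set.image_subset_range _ _, ?_, fun j k hjk => ?_⟩
  · change LinearIndepOn K id _
    refine hli.linearIndepOn_id.mono ?_
    simp only [Set.iUnion_subset_iff]
    rintro i _ _ ⟨_, ⟨a, ha, rfl⟩, rfl⟩
    exact ⟨⟨i, a, ha⟩, rfl⟩
  · rw [I.equivFin.symm.surjective.iUnion_comp
      (fun i : I => (fun a => a * r i) '' (e '' A i)), Set.iUnion_subtype]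
  · refine Set.disjoint_left.2 ?_
    rintro _ ⟨_, ⟨a, ha, rfl⟩, rfl⟩ ⟨_, ⟨b, hb, rfl⟩, h⟩
    have hinj := hli.injective
    have := @hinj ⟨_, b, hb⟩ ⟨_, a, ha⟩ h
    have h1 : (I.equivFin.symm k : ι) = I.equivFin.symm j := (Sigma.mk.inj_iff.1 this).1
    exact hjk (I.equivFin.symm.injective (Subtype.ext h1.symm))

/-- Finite additivity of a dimension-measure on disjoint unions of translates. -/
theorem DimensionMeasure.biUnion {K R ι : Type*} [Field K] [Ring R] [Algebra K R] {e : ℕ → R}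
    {μ : Set R → ℝ} (hμ : DimensionMeasure K e μ) (A : ι → Set ℕ) (r : ι → R)
    (hli : LinearIndependent K fun p : (i : ι) × A i => e p.2 * r p.1) (hr : ∀ i, r i ≠ 0)
    (I : Finset ι) :
    μ (⋃ i ∈ I, (fun a => a * r i) '' (e '' A i)) = ∑ i ∈ I, μ (e '' A i) := by
  classical
  obtain ⟨-, -, -, hadd, hinv⟩ := hμ
  have hreg := regularSubset_biUnion (K := K) A r hli
  induction I using Finset.induction_on with
  | empty =>
    have h0 := hreg ∅
    simp only [Finset.notMem_empty, Set.iUnion_of_empty, Set.iUnion_empty, Finset.sum_empty]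
      at h0 ⊢
    have := hadd ∅ ∅ h0 h0 (Set.disjoint_empty _) (by simpa using h0)
    rw [Set.union_empty] at this
    linarith
  | insert i I hi ih =>
    have hU := hreg (insert i I)
    have hone : RegularSubset K e ((fun a => a * r i) '' (e '' A i)) := by
      simpa using hreg {i}
    have hdisj : Disjoint ((fun a => a * r i) '' (e '' A i))
        (⋃ i ∈ I, (fun a => a * r i) '' (e '' A i)) := by
      rw [Set.disjoint_left]
      rintro _ ⟨_, ⟨a, ha, rfl⟩, rfl⟩ h
      simp only [Set.mem_iUnion] at h
      obtain ⟨j, hj, _, ⟨b, hb, rfl⟩, h⟩ := h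
      have hinj := hli.injective
      have := @hinj ⟨j, b, hb⟩ ⟨i, a, ha⟩ h
      have h1 : j = i := (Sigma.mk.inj_iff.1 this).1
      exact hi (h1 ▸ hj)
    have hbase : RegularSubset K e (e '' A i) := by
      refine ⟨?_, 1, fun _ => e '' A i, fun _ => 1, fun _ => Set.image_subset_range _ _, ?_,
        fun j k hjk => absurd (Subsingleton.elim j k) hjk⟩
      · have h1 : LinearIndependent K fun a : A i => e a * r i :=
          hli.comp (fun a : A i => (⟨i, a⟩ : (i : ι) × A i)) fun a b h => by simpa using h
        have h2 : LinearIndependent K fun a : A i => e a :=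
          LinearIndependent.of_comp (LinearMap.mulRight K (r i)) h1
        exact LinearIndepOn.id_image (v := e) (s := A i) h2
      · simp [Set.iUnion_const]
    rw [Finset.set_biUnion_insert] at hU ⊢
    rw [hadd _ _ hone (hreg I) hdisj hU, ih, Finset.sum_insert hi, hinv _ _ hbase (hr i)]

/-- The existence of an invariant dimension-measure excludes paradoxical decompositions. -/
theorem not_paradoxicalAlgebra_of_dimensionMeasure {K R : Type*} [Field K] [Ring R] [Algebra K R]
    [Nontrivial R] (e : Basis ℕ K R) {μ : Set R → ℝ} (hμ : DimensionMeasure K e μ) :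
    ¬ ParadoxicalAlgebra K R := by
  intro hP
  obtain ⟨m, A, g, h, hg, hh, hcov, hdis, hli⟩ := hP e
  have h1 : μ (⋃ i ∈ Finset.univ, (fun a => a * (1 : R)) '' (e '' A i)) =
      ∑ i, μ (e '' A i) := by
    refine hμ.biUnion A (fun _ => 1) ?_ (fun _ => one_ne_zero) Finset.univ
    simp only [mul_one]
    refine e.linearIndependent.comp (fun p : (i : Fin m) × A i => (p.2 : ℕ)) ?_
    rintro ⟨i, a, ha⟩ ⟨j, b, hb⟩ (rfl : a = b)
    have hij : i = j := by
      by_contra hij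
      exact Set.disjoint_left.1 (hdis hij) ha hb
    subst hij
    rfl
  have h2 : (⋃ i ∈ Finset.univ, (fun a => a * (1 : R)) '' (e '' A i)) = Set.range e := by
    simp only [mul_one, Set.image_id', Finset.mem_univ, Set.iUnion_true]
    rw [← Set.image_iUnion, hcov, Set.image_univ]
  rw [h2, hμ.2.1] at h1
  have hli' : LinearIndependent K fun p : (i : Fin m × Bool) × A i.1 =>
      e p.2 * cond p.1.2 (g p.1.1) (h p.1.1) := by
    refine hli.comp (fun p : (i : Fin m × Bool) × A i.1 =>
      (⟨p.1.1, p.2, p.1.2⟩ : (i : Fin m) × (↥(A i) × Bool))) ?_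
    rintro ⟨⟨i, b⟩, a⟩ ⟨⟨j, c⟩, a'⟩ hp
    simp only [Sigma.mk.injEq] at hp
    obtain ⟨rfl, hp⟩ := hp
    simp only [heq_eq_eq, Prod.mk.injEq] at hp
    obtain ⟨rfl, rfl⟩ := hp
    rfl
  have h3 := hμ.biUnion (fun p : Fin m × Bool => A p.1) (fun p => cond p.2 (g p.1) (h p.1)) hli'
    (by rintro ⟨i, _ | _⟩ <;> simp [hg, hh]) Finset.univ
  have h4 := hμ.2.2.1 _ (regularSubset_biUnion (K := K) (fun p : Fin m × Bool => A p.1)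
    (fun p => cond p.2 (g p.1) (h p.1)) hli' Finset.univ)
  rw [h3, Fintype.sum_prod_type] at h4
  simp only [Fintype.sum_bool, Finset.sum_add_distrib, ← h1] at h4
  linarith

/-- An independent subset of a finite dimensional subspace has at most its dimension many
elements. -/
theorem ncard_le_finrank_of_linearIndepOn {K M : Type*} [Field K] [AddCommGroup M] [Module K M]
    {D : Set M} (hD : LinearIndepOn K id D) (P : Submodule K M) [FiniteDimensional K P]
    (hDP : D ⊆ P) : D.ncard ≤ finrank K P := by
  have hli : LinearIndependent K fun x : D => (⟨x, hDP x.2⟩ : P) :=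
    LinearIndependent.of_comp P.subtype hD
  have := hli.finite
  have := Fintype.ofFinite D
  rw [← Nat.card_coe_set_eq, Nat.card_eq_fintype_card]
  exact hli.fintype_card_le_finrank

/-- Inclusion-exclusion inequality for the dimensions of two subspaces containing `W`. -/
theorem finrank_sup_add_le {K M : Type*} [Field K] [AddCommGroup M] [Module K M]
    {W P Q : Submodule K M} [FiniteDimensional K P] [FiniteDimensional K Q] (hP : W ≤ P)
    (hQ : W ≤ Q) : finrank K ↥(P ⊔ Q) + finrank K W ≤ finrank K P + finrank K Q := by
  have h1 := Submodule.finrank_sup_add_finrank_inf_eq P Q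
  have h2 : finrank K W ≤ finrank K ↥(P ⊓ Q) := Submodule.finrank_mono (le_inf hP hQ)
  omega

instance {K R : Type*} [Field K] [Ring R] [Algebra K R] (W : Submodule K R)
    [FiniteDimensional K W] (r : R) : FiniteDimensional K (rightMulSubmodule K W r) :=
  inferInstanceAs (FiniteDimensional K (W.map (LinearMap.mulRight K r)))

/-- The number of dimensions by which `W·r` sticks out of `W`. -/
noncomputable def boundaryDim (K : Type*) {R : Type*} [Field K] [Ring R] [Algebra K R]
    (W : Submodule K R) (r : R) : ℝ :=
  finrank K ↥(rightMulSubmodule K W r ⊔ W) - finrank K W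

theorem finrank_sup_finsetSup_le {K R : Type*} [Field K] [Ring R] [Algebra K R]
    (W : Submodule K R) [FiniteDimensional K W] (T : Finset R) :
    (finrank K ↥(W ⊔ T.sup (rightMulSubmodule K W)) : ℝ) ≤
      finrank K W + ∑ s ∈ T, boundaryDim K W s := by
  classical
  induction T using Finset.induction_on with
  | empty => rw [Finset.sup_empty, sup_bot_eq, Finset.sum_empty, add_zero]
  | insert s T hs ih =>
    rw [Finset.sup_insert, Finset.sum_insert hs]
    have h1 : W ⊔ (rightMulSubmodule K W s ⊔ T.sup (rightMulSubmodule K W)) =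
        (rightMulSubmodule K W s ⊔ W) ⊔ (W ⊔ T.sup (rightMulSubmodule K W)) := by
      rw [← sup_assoc, ← sup_assoc, sup_assoc _ W W, sup_idem, sup_comm W]
    rw [h1]
    have h2 : (finrank K ↥((rightMulSubmodule K W s ⊔ W) ⊔ (W ⊔ T.sup (rightMulSubmodule K W))) : ℝ)
        + finrank K W ≤ finrank K ↥(rightMulSubmodule K W s ⊔ W) +
          finrank K ↥(W ⊔ T.sup (rightMulSubmodule K W)) := by
      exact_mod_cast finrank_sup_add_le le_sup_right le_sup_left
    rw [boundaryDim]
    linarith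

theorem finrank_rightMul_sup_rightMul_le {K R : Type*} [Field K] [Ring R] [Algebra K R]
    (W : Submodule K R) [FiniteDimensional K W] (s t : R) :
    (finrank K ↥(rightMulSubmodule K W s ⊔ rightMulSubmodule K W t) : ℝ) ≤
      finrank K W + (boundaryDim K W s + boundaryDim K W t) := by
  have h1 : (finrank K ↥((rightMulSubmodule K W s ⊔ W) ⊔ (rightMulSubmodule K W t ⊔ W)) : ℝ)
      + finrank K W ≤ finrank K ↥(rightMulSubmodule K W s ⊔ W) +
        finrank K ↥(rightMulSubmodule K W t ⊔ W) := by
    exact_mod_cast finrank_sup_add_le le_sup_right le_sup_right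
  have h2 : (finrank K ↥(rightMulSubmodule K W s ⊔ rightMulSubmodule K W t) : ℝ) ≤
      finrank K ↥((rightMulSubmodule K W s ⊔ W) ⊔ (rightMulSubmodule K W t ⊔ W)) := by
    exact_mod_cast Submodule.finrank_mono (sup_le_sup le_sup_left le_sup_left)
  simp only [boundaryDim]
  linarith

theorem mulRight_injective_of_ne_zero (K : Type*) {R : Type*} [Field K] [Ring R] [Algebra K R]
    [NoZeroDivisors R] {r : R} (hr : r ≠ 0) : Function.Injective (LinearMap.mulRight K r) := by
  rw [injective_iff_map_eq_zero]
  intro a ha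
  simpa [hr] using ha

/-- Independent vectors of `W·s` of the form `eⱼ·t` with `eⱼ` a basis element outside of `W`
contribute to the dimension of `W·s + W·t`. -/
theorem ncard_add_finrank_le {K R : Type*} [Field K] [Ring R] [Algebra K R] [NoZeroDivisors R]
    (e : Basis ℕ K R) (F : Finset ℕ) {s t : R} (ht : t ≠ 0) {D : Set R}
    (hD : LinearIndepOn K id D) (hs : ∀ x ∈ D, ∃ i ∈ F, e i * s = x)
    (hDt : ∀ x ∈ D, ∃ j ∉ F, e j * t = x) (W : Submodule K R)
    (hW : Submodule.span K (e '' F) = W) :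
    D.ncard + finrank K W ≤
      finrank K ↥(rightMulSubmodule K W s ⊔ rightMulSubmodule K W t) := by
  have hWfd : FiniteDimensional K W := by
    rw [← hW]; exact FiniteDimensional.span_of_finite K (F.finite_toSet.image e)
  have hinj := mulRight_injective_of_ne_zero K ht
  have hDW : Submodule.span K D ≤ rightMulSubmodule K W s := by
    rw [Submodule.span_le]
    intro x hx
    obtain ⟨i, hi, rfl⟩ := hs x hx
    exact ⟨e i, hW ▸ Submodule.subset_span ⟨i, hi, rfl⟩, rfl⟩
  have hfd : FiniteDimensional K (Submodule.span K D) := Submodule.finiteDimensional_of_le hDW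
  have hdisj : Disjoint (Submodule.span K D) (rightMulSubmodule K W t) := by
    have h1 : Disjoint (Submodule.span K (e '' (↑F : Set ℕ)ᶜ)) (Submodule.span K (e '' F)) :=
      e.linearIndependent.disjoint_span_image disjoint_compl_left
    rw [hW] at h1
    refine (Submodule.disjoint_map hinj h1).mono_left ?_
    rw [Submodule.span_le]
    intro x hx
    obtain ⟨j, hj, rfl⟩ := hDt x hx
    exact ⟨e j, Submodule.subset_span ⟨j, hj, rfl⟩, rfl⟩
  have h1 := Submodule.finrank_sup_add_finrank_inf_eq (Submodule.span K D)
    (rightMulSubmodule K W t)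
  rw [hdisj.eq_bot, finrank_bot, add_zero] at h1
  have h2 : finrank K (rightMulSubmodule K W t) = finrank K W :=
    (Submodule.equivMapOfInjective _ hinj W).finrank_eq.symm
  have h3 := ncard_le_finrank_of_linearIndepOn hD _ Submodule.subset_span
  have h4 : finrank K ↥(Submodule.span K D ⊔ rightMulSubmodule K W t) ≤
      finrank K ↥(rightMulSubmodule K W s ⊔ rightMulSubmodule K W t) :=
    Submodule.finrank_mono (sup_le_sup_right hDW _)
  omega

/-- `k` and `r` exhibit every `x ∈ L` as a translate of a basis element: `x = e (k x) * r x`,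
where `r` takes finitely many values on `L`, all of them nonzero. -/
structure IsLabeling {R : Type*} [Ring R] (e : ℕ → R) (L : Set R) (k : R → ℕ) (r : R → R) :
    Prop where
  finite : (r '' L).Finite
  ne_zero : ∀ x ∈ L, r x ≠ 0
  mul_eq : ∀ x ∈ L, e (k x) * r x = x

namespace IsLabeling

variable {R : Type*} [Ring R] {e : ℕ → R} {L : Set R} {k : R → ℕ} {r : R → R}

theorem finite_inter (h : IsLabeling e L k r) (F : Finset ℕ) : (L ∩ {x | k x ∈ F}).Finite := by
  refine ((F.finite_toSet.image2 (fun i s => e i * s) h.finite)).subset ?_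
  rintro x ⟨hx, hk⟩
  exact ⟨k x, hk, r x, ⟨x, hx, rfl⟩, h.mul_eq x hx⟩

theorem ncard_inter_le {K : Type*} [Field K] [Algebra K R] (h : IsLabeling e L k r)
    (hL : LinearIndepOn K id L) (F : Finset ℕ) (W : Submodule K R) [FiniteDimensional K W]
    (hW : Submodule.span K (e '' F) = W) :
    ((L ∩ {x | k x ∈ F}).ncard : ℝ) ≤
      finrank K W + ∑ s ∈ h.finite.toFinset, boundaryDim K W s := by
  refine le_trans ?_ (finrank_sup_finsetSup_le W h.finite.toFinset)
  have := ncard_le_finrank_of_linearIndepOn (hL.mono Set.inter_subset_left)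
    (W ⊔ h.finite.toFinset.sup (rightMulSubmodule K W)) (D := L ∩ {x | k x ∈ F}) ?_
  · exact_mod_cast this
  · rintro x ⟨hx, hk⟩
    refine Submodule.mem_sup_right ?_
    have h1 : rightMulSubmodule K W (r x) ≤ h.finite.toFinset.sup (rightMulSubmodule K W) :=
      Finset.le_sup (f := rightMulSubmodule K W) (by simpa using ⟨x, hx, rfl⟩)
    exact h1 ⟨e (k x), hW ▸ Submodule.subset_span ⟨_, hk, rfl⟩, h.mul_eq x hx⟩

theorem ncard_inter_le_add {K : Type*} [Field K] [Algebra K R] [NoZeroDivisors R]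
    {e : Basis ℕ K R} {k' : R → ℕ} {r' : R → R}
    (h : IsLabeling e L k r) (h' : IsLabeling e L k' r')
    (hL : LinearIndepOn K id L) (F : Finset ℕ) (W : Submodule K R)
    (hW : Submodule.span K (e '' F) = W) :
    ((L ∩ {x | k x ∈ F}).ncard : ℝ) ≤ (L ∩ {x | k' x ∈ F}).ncard +
      ∑ p ∈ h.finite.toFinset ×ˢ h'.finite.toFinset,
        (boundaryDim K W p.1 + boundaryDim K W p.2) := by
  have hWfd : FiniteDimensional K W := by
    rw [← hW]; exact FiniteDimensional.span_of_finite K (F.finite_toSet.image e)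
  let D : R × R → Set R := fun p => {x ∈ L | k x ∈ F ∧ k' x ∉ F ∧ r x = p.1 ∧ r' x = p.2}
  have hDfin : ∀ p, (D p).Finite := fun p =>
    (h.finite_inter F).subset fun x hx => ⟨hx.1, hx.2.1⟩
  have hsub : L ∩ {x | k x ∈ F} ⊆ (L ∩ {x | k' x ∈ F}) ∪
      ⋃ p ∈ h.finite.toFinset ×ˢ h'.finite.toFinset, D p := by
    rintro x ⟨hx, hk⟩
    by_cases hk' : k' x ∈ F
    · exact Or.inl ⟨hx, hk'⟩
    · refine Or.inr (Set.mem_iUnion₂.2 ⟨(r x, r' x), ?_, hx, hk, hk', rfl, rfl⟩)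
      simp only [Finset.mem_product, Set.Finite.mem_toFinset]
      exact ⟨⟨x, hx, rfl⟩, ⟨x, hx, rfl⟩⟩
  have hcard : (L ∩ {x | k x ∈ F}).ncard ≤ (L ∩ {x | k' x ∈ F}).ncard +
      ∑ p ∈ h.finite.toFinset ×ˢ h'.finite.toFinset, (D p).ncard := by
    refine (Set.ncard_le_ncard hsub ?_).trans ((Set.ncard_union_le _ _).trans ?_)
    · exact (h'.finite_inter F).union (Set.Finite.biUnion (Finset.finite_toSet _) fun p _ => hDfin p)
    · gcongr
      exact Finset.set_ncard_biUnion_le _ _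
  have hcard' : ((L ∩ {x | k x ∈ F}).ncard : ℝ) ≤ (L ∩ {x | k' x ∈ F}).ncard +
      ∑ p ∈ h.finite.toFinset ×ˢ h'.finite.toFinset, ((D p).ncard : ℝ) := by
    exact_mod_cast hcard
  refine hcard'.trans ?_
  gcongr with p hp
  simp only [Finset.mem_product, Set.Finite.mem_toFinset] at hp
  obtain ⟨-, y, hy, hp2⟩ := hp
  have h1 : ((D p).ncard : ℝ) + finrank K W ≤
      finrank K ↥(rightMulSubmodule K W p.1 ⊔ rightMulSubmodule K W p.2) := by
    exact_mod_cast ncard_add_finrank_le e F (D := D p) (hp2 ▸ h'.ne_zero y hy)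
      (hL.mono fun x hx => hx.1)
      (fun x hx => ⟨k x, hx.2.1, by rw [← hx.2.2.2.1]; exact h.mul_eq x hx.1⟩)
      (fun x hx => ⟨k' x, hx.2.2.1, by rw [← hx.2.2.2.2]; exact h'.mul_eq x hx.1⟩) W hW
  have h2 := finrank_rightMul_sup_rightMul_le (K := K) W p.1 p.2
  linarith

end IsLabeling

/-- `S` describes a Følner exhaustion by spans of finite parts of the basis `e`. -/
structure FolnerBasis (K : Type*) {R : Type*} [Field K] [Ring R] [Algebra K R]
    (e : Basis ℕ K R) (S : ℕ → Finset ℕ) : Prop where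
  eventually_pos : ∀ᶠ n in atTop, 0 < (S n).card
  tendsto : ∀ r : R, Tendsto
    (fun n => boundaryDim K (Submodule.span K (e '' S n)) r / (S n).card) atTop (nhds 0)

/-- `L` has a labelling for which the proportion of the elements of `L` with label in `S n`
converges to `a` along a fixed non-principal ultrafilter. -/
def HasDensity {R : Type*} [Ring R] (e : ℕ → R) (S : ℕ → Finset ℕ) (L : Set R) (a : ℝ) : Prop :=
  ∃ (k : R → ℕ) (r : R → R), IsLabeling e L k r ∧
    Tendsto (fun n => ((L ∩ {x | k x ∈ S n}).ncard : ℝ) / (S n).card) (hyperfilter ℕ) (nhds a)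

theorem finrank_span_image_basis {K R : Type*} [Field K] [Ring R] [Algebra K R]
    (e : Basis ℕ K R) (F : Finset ℕ) : finrank K (Submodule.span K (e '' F)) = F.card := by
  classical
  rw [← Finset.coe_image, finrank_span_finset_eq_card,
    Finset.card_image_of_injective _ e.injective]
  exact e.linearIndependent.linearIndepOn_id.mono (by simp)

/-- A bounded real sequence converges along every ultrafilter. -/
theorem exists_tendsto_ultrafilter {ι : Type*} (U : Ultrafilter ι) (u : ι → ℝ) (C : ℝ)
    (h : ∀ᶠ n in U, u n ∈ Set.Icc 0 C) : ∃ a, Tendsto u U (nhds a) := by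
  obtain ⟨a, -, ha⟩ := isCompact_iff_ultrafilter_le_nhds.1 (isCompact_Icc (a := (0 : ℝ)) (b := C))
    (U.map u) (le_principal_iff.2 h)
  exact ⟨a, ha⟩

/-- A regular set has a labelling. -/
theorem RegularSubset.exists_isLabeling {K R : Type*} [Field K] [Ring R] [Algebra K R]
    {e : ℕ → R} {L : Set R} (hL : RegularSubset K e L) : ∃ k r, IsLabeling e L k r := by
  classical
  obtain ⟨hli, n, A, r, hA, rfl, -⟩ := hL
  have h0 : ∀ x ∈ ⋃ i, (fun a => a * r i) '' A i, x ≠ 0 := fun x hx => hli.ne_zero ⟨x, hx⟩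
  have hex : ∀ x : R, ∃ p : ℕ × R, x ∈ ⋃ i, (fun a => a * r i) '' A i →
      p.2 ∈ Set.range r ∧ e p.1 * p.2 = x := by
    intro x
    by_cases hx : x ∈ ⋃ i, (fun a => a * r i) '' A i
    · obtain ⟨i, a, ha, hax⟩ := Set.mem_iUnion.1 hx
      obtain ⟨k, rfl⟩ := hA i ha
      exact ⟨(k, r i), fun _ => ⟨⟨i, rfl⟩, hax⟩⟩
    · exact ⟨(0, 0), fun h => absurd h hx⟩
  choose p hp using hex
  refine ⟨fun x => (p x).1, fun x => (p x).2, (Set.finite_range r).subset ?_, fun x hx h => ?_,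
    fun x hx => (hp x hx).2⟩
  · rintro _ ⟨x, hx, rfl⟩
    exact (hp x hx).1
  · have := (hp x hx).2
    rw [h, mul_zero] at this
    exact h0 x hx this.symm

namespace HasDensity

variable {K R : Type*} [Field K] [Ring R] [Algebra K R] {e : Basis ℕ K R} {S : ℕ → Finset ℕ}
  {L L' : Set R} {a b : ℝ}

theorem nonneg (h : HasDensity e S L a) : 0 ≤ a := by
  obtain ⟨k, r, -, h⟩ := h
  exact ge_of_tendsto' h fun n => by positivity

theorem tendsto_bound (hS : FolnerBasis K e S) (T : Finset R) :
    Tendsto (fun n => 1 + ∑ s ∈ T, boundaryDim K (Submodule.span K (e '' S n)) s / (S n).card)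
      (hyperfilter ℕ) (nhds 1) := by
  have := (tendsto_finsetSum T fun s _ => hS.tendsto s).const_add 1
  simp only [Finset.sum_const_zero, add_zero] at this
  exact this.mono_left Nat.hyperfilter_le_atTop

theorem ratio_le (hS : FolnerBasis K e S) {k : R → ℕ} {r : R → R} (h : IsLabeling e L k r)
    (hL : LinearIndepOn K id L) :
    ∀ᶠ n in hyperfilter ℕ, ((L ∩ {x | k x ∈ S n}).ncard : ℝ) / (S n).card ≤
      1 + ∑ s ∈ h.finite.toFinset,
        boundaryDim K (Submodule.span K (e '' S n)) s / (S n).card := by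
  filter_upwards [hS.eventually_pos.filter_mono Nat.hyperfilter_le_atTop] with n hn
  have hn' : (0 : ℝ) < (S n).card := by exact_mod_cast hn
  have := FiniteDimensional.span_of_finite K ((S n).finite_toSet.image e)
  have h1 := h.ncard_inter_le hL (S n) _ rfl
  rw [finrank_span_image_basis] at h1
  rw [← Finset.sum_div, div_le_iff₀ hn', add_mul, div_mul_cancel₀ _ hn'.ne', one_mul]
  exact h1

theorem le_one (hS : FolnerBasis K e S) (hL : LinearIndepOn K id L) (h : HasDensity e S L a) :
    a ≤ 1 := by
  obtain ⟨k, r, h, hlim⟩ := h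
  exact le_of_tendsto_of_tendsto hlim (tendsto_bound hS _) (ratio_le hS h hL)

theorem exists_of_regularSubset (hS : FolnerBasis K e S) (hL : RegularSubset K e L) :
    ∃ a, HasDensity e S L a := by
  obtain ⟨k, r, h⟩ := hL.exists_isLabeling
  obtain ⟨a, ha⟩ := exists_tendsto_ultrafilter (hyperfilter ℕ)
    (fun n => ((L ∩ {x | k x ∈ S n}).ncard : ℝ) / (S n).card) 2 (by
      filter_upwards [ratio_le hS h hL.1, (tendsto_bound hS h.finite.toFinset).eventually
        (ge_mem_nhds (by norm_num : (1 : ℝ) < 2))] with n h1 h2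
      exact ⟨by positivity, h1.trans h2⟩)
  exact ⟨a, k, r, h, ha⟩

theorem le_of_hasDensity [NoZeroDivisors R] (hS : FolnerBasis K e S) (hL : LinearIndepOn K id L)
    (h : HasDensity e S L a) (h' : HasDensity e S L b) : a ≤ b := by
  obtain ⟨k, r, h, hlim⟩ := h
  obtain ⟨k', r', h', hlim'⟩ := h'
  have herr : Tendsto (fun n => ∑ p ∈ h.finite.toFinset ×ˢ h'.finite.toFinset,
      (boundaryDim K (Submodule.span K (e '' S n)) p.1 / (S n).card +
        boundaryDim K (Submodule.span K (e '' S n)) p.2 / (S n).card)) (hyperfilter ℕ)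
      (nhds 0) := by
    have := tendsto_finsetSum (h.finite.toFinset ×ˢ h'.finite.toFinset)
      fun p _ => (hS.tendsto p.1).add (hS.tendsto p.2)
    simp only [add_zero, Finset.sum_const_zero] at this
    exact this.mono_left Nat.hyperfilter_le_atTop
  have hsum := hlim'.add herr
  rw [add_zero] at hsum
  refine le_of_tendsto_of_tendsto hlim hsum ?_
  filter_upwards [hS.eventually_pos.filter_mono Nat.hyperfilter_le_atTop] with n hn
  have hn' : (0 : ℝ) < (S n).card := by exact_mod_cast hn
  have h1 := h.ncard_inter_le_add (K := K) h' hL (S n) _ rfl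
  simp only [← add_div, ← Finset.sum_div]
  gcongr

theorem unique [NoZeroDivisors R] (hS : FolnerBasis K e S) (hL : LinearIndepOn K id L)
    (h : HasDensity e S L a) (h' : HasDensity e S L b) : a = b :=
  le_antisymm (le_of_hasDensity hS hL h h') (le_of_hasDensity hS hL h' h)

theorem range [Nontrivial R] (hS : FolnerBasis K e S) : HasDensity e S (Set.range e) 1 := by
  have hk := Function.leftInverse_invFun e.injective
  refine ⟨Function.invFun e, fun _ => 1, ⟨(Set.finite_singleton (1 : R)).subset ?_, ?_, ?_⟩, ?_⟩
  · rintro _ ⟨_, _, rfl⟩; rfl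
  · exact fun _ _ => one_ne_zero
  · rintro _ ⟨i, rfl⟩
    rw [hk i, mul_one]
  · refine tendsto_const_nhds.congr' ?_
    filter_upwards [hS.eventually_pos.filter_mono Nat.hyperfilter_le_atTop] with n hn
    have h1 : Set.range e ∩ {x | Function.invFun e x ∈ S n} = e '' S n := by
      ext x
      constructor
      · rintro ⟨⟨i, rfl⟩, hi⟩
        exact ⟨i, by simpa [hk i] using hi, rfl⟩
      · rintro ⟨i, hi, rfl⟩
        exact ⟨⟨i, rfl⟩, by simpa [hk i] using hi⟩
    rw [h1, Set.ncard_image_of_injective _ e.injective, Set.ncard_coe_finset, div_self]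
    exact_mod_cast hn.ne'

theorem union (hLL' : Disjoint L L') (h : HasDensity e S L a) (h' : HasDensity e S L' b) :
    HasDensity e S (L ∪ L') (a + b) := by
  classical
  obtain ⟨k, r, h, hlim⟩ := h
  obtain ⟨k', r', h', hlim'⟩ := h'
  have hnot : ∀ x ∈ L', x ∉ L := fun x hx hx' => Set.disjoint_left.1 hLL' hx' hx
  refine ⟨fun x => if x ∈ L then k x else k' x, fun x => if x ∈ L then r x else r' x,
    ⟨(h.finite.union h'.finite).subset ?_, ?_, ?_⟩, ?_⟩
  · rintro _ ⟨x, hx | hx, rfl⟩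
    · exact Or.inl ⟨x, hx, by simp [hx]⟩
    · exact Or.inr ⟨x, hx, by simp [hnot x hx]⟩
  · rintro x (hx | hx)
    · simpa [hx] using h.ne_zero x hx
    · simpa [hnot x hx] using h'.ne_zero x hx
  · rintro x (hx | hx)
    · simpa [hx] using h.mul_eq x hx
    · simpa [hnot x hx] using h'.mul_eq x hx
  · refine (hlim.add hlim').congr fun n => ?_
    have h1 : (L ∪ L') ∩ {x | (if x ∈ L then k x else k' x) ∈ S n} =
        (L ∩ {x | k x ∈ S n}) ∪ (L' ∩ {x | k' x ∈ S n}) := by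
      rw [Set.union_inter_distrib_right]
      congr 1
      · ext x
        simp +contextual
      · ext x
        simp +contextual [hnot]
    rw [h1, Set.ncard_union_eq (hLL'.mono Set.inter_subset_left Set.inter_subset_left)
      (h.finite_inter _) (h'.finite_inter _), Nat.cast_add, add_div]

theorem image_mulRight [NoZeroDivisors R] (h : HasDensity e S L a) {s : R} (hs : s ≠ 0) :
    HasDensity e S ((fun x => x * s) '' L) a := by
  obtain ⟨k, r, h, hlim⟩ := h
  have hinj : Function.Injective fun x => x * s := mulRight_injective_of_ne_zero K hs
  have hφ := Function.leftInverse_invFun hinj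
  set φ := Function.invFun fun x => x * s
  refine ⟨fun y => k (φ y), fun y => r (φ y) * s, ⟨(h.finite.image (· * s)).subset ?_, ?_, ?_⟩, ?_⟩
  · rintro _ ⟨_, ⟨x, hx, rfl⟩, rfl⟩
    exact ⟨r x, ⟨x, hx, rfl⟩, by simp [hφ x]⟩
  · rintro _ ⟨x, hx, rfl⟩
    rw [hφ x]
    exact mul_ne_zero (h.ne_zero x hx) hs
  · rintro _ ⟨x, hx, rfl⟩
    rw [hφ x, ← mul_assoc, h.mul_eq x hx]
  · refine hlim.congr fun n => ?_
    have h1 : (fun x => x * s) '' L ∩ {y | k (φ y) ∈ S n} =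
        (fun x => x * s) '' (L ∩ {x | k x ∈ S n}) := by
      ext y
      constructor
      · rintro ⟨⟨x, hx, rfl⟩, hy⟩
        exact ⟨x, ⟨hx, by simpa only [Set.mem_ofPred_eq, hφ x] using hy⟩, rfl⟩
      · rintro ⟨x, ⟨hx, hy⟩, rfl⟩
        exact ⟨⟨x, hx, rfl⟩, by simpa only [Set.mem_ofPred_eq, hφ x] using hy⟩
    rw [h1, Set.ncard_image_of_injective _ hinj]

end HasDensity

/-- A basis adapted to a Følner exhaustion carries an invariant dimension-measure. -/
theorem FolnerBasis.exists_dimensionMeasure {K R : Type*} [Field K] [Ring R] [Algebra K R]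
    [Nontrivial R] [NoZeroDivisors R] {e : Basis ℕ K R} {S : ℕ → Finset ℕ}
    (hS : FolnerBasis K e S) : ∃ μ : Set R → ℝ, DimensionMeasure K e μ := by
  classical
  let μ : Set R → ℝ := fun L => if h : ∃ a, HasDensity e S L a then h.choose else 0
  have hμ : ∀ L, RegularSubset K e L → HasDensity e S L (μ L) := by
    intro L hL
    have h := HasDensity.exists_of_regularSubset hS hL
    simp only [μ, dif_pos h]
    exact h.choose_spec
  have hμeq : ∀ L a, LinearIndepOn K id L → HasDensity e S L a → μ L = a := by
    intro L a hL ha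
    have h : ∃ a, HasDensity e S L a := ⟨a, ha⟩
    simp only [μ, dif_pos h]
    exact h.choose_spec.unique hS hL ha
  refine ⟨μ, fun L hL => (hμ L hL).nonneg,
    hμeq _ _ e.linearIndependent.linearIndepOn_id (HasDensity.range hS),
    fun L hL => (hμ L hL).le_one hS hL.1,
    fun A B hA hB hAB hU => hμeq _ _ hU.1 ((hμ A hA).union hAB (hμ B hB)),
    fun A r hA hr => hμeq _ _ ?_ ((hμ A hA).image_mulRight hr)⟩
  have hli : LinearIndepOn K id A := hA.1
  exact (hli.map_injOn (LinearMap.mulRight K r)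
    (mulRight_injective_of_ne_zero K hr).injOn).id_image

/-- An exhaustion by finite dimensional subspaces has an adapted basis. -/
theorem exists_basis_of_exhaustion {K R : Type*} [Field K] [Ring R] [Algebra K R]
    (hinf : ¬ FiniteDimensional K R) {W : ℕ → Submodule K R} (hmono : Monotone W)
    (hfd : ∀ n, FiniteDimensional K (W n)) (hex : ∀ x : R, ∃ n, x ∈ W n) :
    ∃ (e : Basis ℕ K R) (S : ℕ → Finset ℕ), ∀ n, Submodule.span K (e '' S n) = W n := by
  classical
  have hstep : ∀ (T : Submodule K R) (b : {b : Set R // LinearIndepOn K id b}),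
      ∃ b' : {b : Set R // LinearIndepOn K id b},
        b.1 ⊆ T → b.1 ⊆ b'.1 ∧ b'.1 ⊆ T ∧ (T : Set R) ⊆ Submodule.span K b'.1 := by
    intro T b
    by_cases hb : b.1 ⊆ T
    · obtain ⟨b', h1, h2, h3, h4⟩ := exists_linearIndepOn_id_extension b.2 hb
      exact ⟨⟨b', h4⟩, fun _ => ⟨h2, h1, h3⟩⟩
    · exact ⟨b, fun h => absurd h hb⟩
  choose next hnext using hstep
  let B : ℕ → {b : Set R // LinearIndepOn K id b} := fun n =>
    Nat.rec (next (W 0) ⟨∅, linearIndependent_empty K R⟩) (fun n b => next (W (n + 1)) b) n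
  have hBsucc : ∀ n, B (n + 1) = next (W (n + 1)) (B n) := fun n => rfl
  have hB0 := hnext (W 0) ⟨∅, linearIndependent_empty K R⟩ (Set.empty_subset _)
  have hBW : ∀ n, (B n).1 ⊆ W n := by
    intro n
    induction n with
    | zero => exact hB0.2.1
    | succ n ih => exact (hnext (W (n + 1)) (B n) (ih.trans (hmono n.le_succ))).2.1
  have hBn : ∀ n, (B n).1 ⊆ (B (n + 1)).1 ∧
      (W (n + 1) : Set R) ⊆ Submodule.span K (B (n + 1)).1 := fun n => by
    have := hnext (W (n + 1)) (B n) ((hBW n).trans (hmono n.le_succ))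
    exact ⟨this.1, this.2.2⟩
  have hspan : ∀ n, Submodule.span K (B n).1 = W n := by
    intro n
    refine le_antisymm (Submodule.span_le.2 (hBW n)) ?_
    cases n with
    | zero => exact hB0.2.2
    | succ n => exact (hBn n).2
  have hBmono : Monotone fun n => (B n).1 := monotone_nat_of_le_succ fun n => (hBn n).1
  have hBfin : ∀ n, (B n).1.Finite := fun n => by
    have hli : LinearIndependent K fun x : (B n).1 => (⟨x, hBW n x.2⟩ : W n) :=
      LinearIndependent.of_comp (W n).subtype (B n).2
    exact hli.finite
  let U : Set R := ⋃ n, (B n).1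
  have hU : LinearIndepOn K id U :=
    linearIndepOn_iUnion_of_directed hBmono.directed_le fun n => (B n).2
  have hUspan : ⊤ ≤ Submodule.span K (Set.range ((↑) : U → R)) := by
    intro x _
    obtain ⟨n, hn⟩ := hex x
    rw [Subtype.range_coe]
    rw [← hspan n] at hn
    exact Submodule.span_mono (Set.subset_iUnion (fun n => (B n).1) n) hn
  let b : Basis U K R := Basis.mk hU hUspan
  have hcount : Countable U := (Set.countable_iUnion fun n => (hBfin n).countable).to_subtype
  have hinfU : Infinite U := by
    by_contra h
    have : Finite U := not_infinite_iff_finite.1 h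
    exact hinf (Module.Finite.of_basis b)
  obtain ⟨hden⟩ := nonempty_denumerable U
  let eqv := Denumerable.eqv U
  let e : Basis ℕ K R := b.reindex eqv
  have he : ∀ x : U, e (eqv x) = x := fun x => by simp [e, b]
  have hfin : ∀ n, {i | e i ∈ (B n).1}.Finite := fun n =>
    (hBfin n).preimage e.injective.injOn
  refine ⟨e, fun n => (hfin n).toFinset, fun n => ?_⟩
  rw [← hspan n]
  congr 1
  ext x
  simp only [Set.Finite.coe_toFinset, Set.mem_image, Set.mem_ofPred_eq]
  constructor
  · rintro ⟨i, hi, rfl⟩; exact hi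
  · intro hx
    have hxU : x ∈ U := Set.mem_iUnion.2 ⟨n, hx⟩
    exact ⟨eqv ⟨x, hxU⟩, by rwa [he], he _⟩

/-- An infinite dimensional amenable algebra without zero divisors has an invariant
dimension-measure. -/
theorem AmenableAlgebra.exists_dimensionMeasure {K R : Type*} [Field K] [Ring R] [Algebra K R]
    [Nontrivial R] [NoZeroDivisors R] (hinf : ¬ FiniteDimensional K R)
    (h : AmenableAlgebra K R) :
    ∃ (e : Basis ℕ K R) (μ : Set R → ℝ), DimensionMeasure K e μ := by
  obtain ⟨W, hmono, hfd, hex, hlim⟩ := h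
  obtain ⟨e, S, hS⟩ := exists_basis_of_exhaustion hinf hmono hfd hex
  have hcard : ∀ n, finrank K (W n) = (S n).card := fun n => by
    rw [← hS, finrank_span_image_basis]
  have hpos : ∀ᶠ n in atTop, 0 < (S n).card := by
    obtain ⟨N, hN⟩ := hex 1
    filter_upwards [eventually_ge_atTop N] with n hn
    rw [← hcard]
    have := hfd n
    exact finrank_pos_iff_exists_ne_zero.2 ⟨⟨1, hmono hn hN⟩, by simp⟩
  have hFB : FolnerBasis K e S := by
    refine ⟨hpos, fun r => ?_⟩
    have h1 := (hlim r).sub_const 1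
    rw [sub_self] at h1
    refine h1.congr' ?_
    filter_upwards [hpos] with n hn
    have hn' : ((S n).card : ℝ) ≠ 0 := by exact_mod_cast hn.ne'
    rw [hS, boundaryDim, hcard, sub_div, div_self hn']
  exact ⟨e, hFB.exists_dimensionMeasure⟩

/-- Main theorem: for an infinite dimensional affine algebra without zero divisors the
following are equivalent: (1) `R` is amenable; (2) `R` is not paradoxical; (3) there is a
basis `{eᵢ}` of `R` and an invariant finitely additive dimension-measure with respect to it. -/
theorem amenable_tfae (K : Type*) [Field K] (R : Type*) [Ring R] [Algebra K R]
    [Algebra.FiniteType K R] [NoZeroDivisors R]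
    (hinf : ¬ FiniteDimensional K R) :
    (AmenableAlgebra K R ↔ ¬ ParadoxicalAlgebra K R) ∧
    (AmenableAlgebra K R ↔
      ∃ (e : Basis ℕ K R) (μ : Set R → ℝ), DimensionMeasure K ⇑e μ) := by
  have : Nontrivial R := by
    by_contra h
    have := not_nontrivial_iff_subsingleton.1 h
    exact hinf inferInstance
  have h13 := AmenableAlgebra.exists_dimensionMeasure (K := K) (R := R) hinf
  have h32 : (∃ (e : Basis ℕ K R) (μ : Set R → ℝ), DimensionMeasure K ⇑e μ) →
      ¬ ParadoxicalAlgebra K R :=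
    fun ⟨e, _, hμ⟩ => not_paradoxicalAlgebra_of_dimensionMeasure e hμ
  have h21 := amenableAlgebra_of_not_paradoxicalAlgebra (K := K) (R := R)
  exact ⟨⟨fun h => h32 (h13 h), h21⟩, ⟨h13, fun h => h21 (h32 h)⟩⟩
end
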